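/- Let A be a bounded self-adjoint operator on a complex Hilbert space 𝓗 and let φ ∈ 𝓗 be non-zero. For λ ∈ ℝ set A_λ = A + λ ⟨φ, ·⟩ φ. Then for every continuous compactly supported function f : ℝ → ℝ, the function λ ↦ ⟨φ, f(A_λ) φ⟩ (which is real-valued, f(A_λ) being defined by the continuous functional calculus) is integrable over ℝ, and ∫_ℝ ⟨φ, f(A_λ) φ⟩ dλ = ∫_ℝ f(E) dE. -/

import Mathlib

open MeasureTheory
/-- Poisson kernel -/
noncomputable def pk (y x E : ℝ) : ℝ := Real.pi⁻¹ * y * ((E - x) ^ 2 + y ^ 2)⁻¹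

lemma pk_eq {y : ℝ} (hy : 0 < y) (x : ℝ) :
    pk y x = ProbabilityTheory.cauchyPDFReal x y.toNNReal := by
  ext E
  simp [pk, ProbabilityTheory.cauchyPDFReal_def, hy.le]

lemma pk_symm (y x E : ℝ) : pk y x E = pk y E x := by
  unfold pk
  rw [show (E - x) ^ 2 = (x - E) ^ 2 by ring]

lemma pk_pos {y : ℝ} (hy : 0 < y) (x E : ℝ) : 0 < pk y x E := by
  unfold pk; positivity

lemma pk_le {y : ℝ} (hy : 0 < y) (x E : ℝ) : pk y x E ≤ Real.pi⁻¹ * y⁻¹ := by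
  unfold pk
  rw [mul_assoc]
  gcongr
  rw [← div_eq_mul_inv, div_le_iff₀ (by positivity)]
  have : y⁻¹ * ((E - x) ^ 2 + y ^ 2) = y⁻¹ * (E - x) ^ 2 + y := by field_simp
  rw [this]
  have : 0 ≤ y⁻¹ * (E - x) ^ 2 := by positivity
  linarith

lemma pk_integral {y : ℝ} (hy : 0 < y) (x : ℝ) : ∫ E, pk y x E = 1 := by
  rw [pk_eq hy]
  exact ProbabilityTheory.integral_cauchyPDFReal_eq_one x (by simpa using hy)

lemma pk_integrable {y : ℝ} (hy : 0 < y) (x : ℝ) : Integrable (pk y x) := by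
  by_contra h
  have := pk_integral hy x
  rw [integral_undef h] at this
  exact zero_ne_one this

lemma pk_cont {y : ℝ} (hy : 0 < y) : Continuous (fun p : ℝ × ℝ => pk y p.1 p.2) := by
  unfold pk
  refine Continuous.mul (by fun_prop) (Continuous.inv₀ (by fun_prop) ?_)
  intro p; positivity

lemma pk_cont' {y : ℝ} (hy : 0 < y) (x : ℝ) : Continuous (pk y x) :=
  (pk_cont hy).comp (by fun_prop : Continuous fun E : ℝ => (x, E))

section
variable {H : Type*} [NormedAddCommGroup H] [InnerProductSpace ℂ H] [CompleteSpace H]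

lemma pk_inner (B : H →L[ℂ] H) (hB : IsSelfAdjoint B) (φ χ : H) (x y : ℝ) (hy : 0 < y)
    (hχ : B χ - ((x : ℂ) + y * Complex.I) • χ = φ) :
    (inner (𝕜 := ℂ) φ (cfc (pk y x) B φ)).re = Real.pi⁻¹ * y * ‖χ‖ ^ 2 := by
  set K := cfc (pk y x) B with hK
  have hq : cfc (fun E : ℝ => (E - x) ^ 2 + y ^ 2) B
      = B * B - (2 * x) • B + (x ^ 2 + y ^ 2) • (1 : H →L[ℂ] H) := by
    have : (fun E : ℝ => (E - x) ^ 2 + y ^ 2)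
        = (Polynomial.X ^ 2 - Polynomial.C (2 * x) * Polynomial.X
          + Polynomial.C (x ^ 2 + y ^ 2) : Polynomial ℝ).eval := by
      ext E; simp; ring
    rw [this, cfc_polynomial _ B hB]
    simp only [map_add, map_sub, map_mul, map_pow, Polynomial.aeval_X, Polynomial.aeval_C,
      Algebra.algebraMap_eq_smul_one, pow_two]
    simp [add_smul, mul_smul, two_smul, add_mul]
  have hKq : K * cfc (fun E : ℝ => (E - x) ^ 2 + y ^ 2) B
      = (Real.pi⁻¹ * y) • (1 : H →L[ℂ] H) := by
    rw [hK, ← cfc_mul _ _ B (pk_cont' hy x).continuousOn (by fun_prop)]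
    rw [← Algebra.algebraMap_eq_smul_one, ← cfc_const (Real.pi⁻¹ * y) B hB]
    congr 1
    ext E
    unfold pk
    have : (E - x) ^ 2 + y ^ 2 ≠ 0 := by positivity
    field_simp
  have hcomm : Commute B K := by
    have := cfc_commute_cfc (id : ℝ → ℝ) (pk y x) B
    rwa [cfc_id ℝ B hB] at this
  have hsym : ∀ u v, inner ℂ (B u) v = inner ℂ u (B v) := by
    intro u v
    exact (ContinuousLinearMap.isSelfAdjoint_iff_isSymmetric.1 hB) u v
  have hc : ∀ u, B (K u) = K (B u) := fun u => by
    have := congrArg (fun T : H →L[ℂ] H => T u) hcomm.eq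
    simpa using this
  have h1 : K (B (B χ)) - (2 * x : ℂ) • K (B χ) + (x ^ 2 + y ^ 2 : ℂ) • K χ
      = (Real.pi⁻¹ * y : ℂ) • χ := by
    have := congrArg (fun T : H →L[ℂ] H => T χ) hKq
    rw [hq] at this
    simp only [mul_apply_eq_comp, add_apply,
      sub_apply, smul_apply, map_add, map_sub,
      one_apply_eq_self, ← Complex.coe_smul, map_smul] at this
    push_cast at this ⊢
    exact this
  have h2 : inner ℂ φ (K φ) = (Real.pi⁻¹ * y : ℂ) * inner ℂ χ χ := by
    rw [← inner_smul_right, ← h1, ← hχ]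
    simp only [inner_sub_left, inner_sub_right, inner_add_right, inner_smul_left, inner_smul_right,
      map_sub, map_smul, hsym, hc, map_add, Complex.conj_ofReal, map_mul, Complex.conj_I]
    ring_nf
    simp only [Complex.I_sq]
    ring
  rw [h2, inner_self_eq_norm_sq_to_K]
  have h3 : ((Real.pi⁻¹ : ℝ) * y : ℂ) * (‖χ‖ : ℂ) ^ 2
      = ((Real.pi⁻¹ * y * ‖χ‖ ^ 2 : ℝ) : ℂ) := by push_cast; ring
  exact (congrArg Complex.re h3).trans (Complex.ofReal_re _)

lemma rank_one_pk (A : H →L[ℂ] H) (hA : IsSelfAdjoint A) (φ : H) (hφ : φ ≠ 0)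
    (Alam : ℝ → (H →L[ℂ] H)) (hsa : ∀ l, IsSelfAdjoint (Alam l))
    (hAlam : ∀ lam : ℝ, Alam lam = A + (lam : ℂ) • ((innerSL ℂ φ).smulRight φ))
    (y : ℝ) (hy : 0 < y) :
    ∃ a b : ℝ → ℝ, Measurable a ∧ Measurable b ∧ (∀ x, 0 < b x) ∧ ∀ l x,
      (inner (𝕜 := ℂ) φ (cfc (pk y x) (Alam l) φ)).re = pk (b x) (a x) l := by
  set z : ℝ → ℂ := fun x => (x : ℂ) + y * Complex.I with hz
  have hres : ∀ x, z x ∈ resolventSet ℂ A := by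
    intro x
    by_contra h
    have := hA.im_eq_zero_of_mem_spectrum (z := z x) h
    simp [hz] at this
    exact hy.ne' this
  set ψ : ℝ → H := fun x => -(resolvent A (z x) φ) with hψ
  have hψc : Continuous ψ := by
    have : Continuous fun x => resolvent A (z x) := by
      refine continuous_iff_continuousAt.2 fun x => ?_
      have h1 := (spectrum.hasDerivAt_resolvent_const_left (hres x)).continuousAt
      exact ContinuousAt.comp (f := z) (g := resolvent A) h1
        (by simp only [hz]; fun_prop)
    exact (this.clm_apply continuous_const).neg
  have hψe : ∀ x, A (ψ x) - z x • ψ x = φ := by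
    intro x
    have h1 : (algebraMap ℂ (H →L[ℂ] H) (z x) - A) * resolvent A (z x) = 1 :=
      Ring.mul_inverse_cancel _ (hres x)
    have := congrArg (fun T : H →L[ℂ] H => T φ) h1
    simp [Algebra.algebraMap_eq_smul_one] at this
    simp only [hψ, map_neg, smul_neg]
    rw [sub_neg_eq_add, ← sub_eq_neg_add]
    exact this
  have hψ0 : ∀ x, ψ x ≠ 0 := by
    intro x h
    have := hψe x
    rw [h] at this
    simp at this
    exact hφ this.symm
  set F : ℝ → ℂ := fun x => inner ℂ φ (ψ x) with hF
  have hFc : Continuous F := continuous_const.inner hψc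
  have hsym : ∀ u v, inner ℂ (A u) v = inner ℂ u (A v) := fun u v =>
    (ContinuousLinearMap.isSelfAdjoint_iff_isSymmetric.1 hA) u v
  have hFim : ∀ x, (F x).im = y * ‖ψ x‖ ^ 2 := by
    intro x
    have h0 : (inner ℂ (A (ψ x)) (ψ x) : ℂ).im = 0 := by
      rw [← Complex.conj_eq_iff_im, inner_conj_symm]
      exact (hsym _ _).symm
    have : F x = inner ℂ (A (ψ x)) (ψ x) - (starRingEnd ℂ) (z x) * ((‖ψ x‖ ^ 2 : ℝ) : ℂ) := by
      simp only [hF]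
      conv_lhs => rw [← hψe x]
      rw [inner_sub_left, inner_smul_left, inner_self_eq_norm_sq_to_K]
      norm_cast
    rw [this, Complex.sub_im, h0, Complex.im_mul_ofReal]
    simp [hz]
  have hFpos : ∀ x, 0 < (F x).im := by
    intro x
    rw [hFim]
    have := norm_pos_iff.2 (hψ0 x)
    positivity
  refine ⟨fun x => -((F x).re / Complex.normSq (F x)), fun x => (F x).im / Complex.normSq (F x),
    ?_, ?_, ?_, ?_⟩
  · have := hFc.measurable
    fun_prop
  · have := hFc.measurable
    fun_prop
  · intro x
    have h1 : F x ≠ 0 := fun h => (hFpos x).ne' (by simp [h])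
    exact div_pos (hFpos x) (Complex.normSq_pos.2 h1)
  · intro l x
    have h1 : F x ≠ 0 := fun h => (hFpos x).ne' (by simp [h])
    have hN := Complex.normSq_pos.2 h1
    have h2 : 1 + (l : ℂ) * F x ≠ 0 := by
      intro h
      have him := congrArg Complex.im h
      have hre := congrArg Complex.re h
      simp at him hre
      rcases him with him | him
      · simp [him] at hre
      · exact (hFpos x).ne' him
    rw [pk_inner (Alam l) (hsa l) φ ((1 + (l : ℂ) * F x)⁻¹ • ψ x) x y hy]
    · rw [norm_smul, mul_pow, mul_assoc, ← mul_assoc y, mul_comm y, mul_assoc, ← hFim, norm_inv,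
        inv_pow, Complex.sq_norm]
      unfold pk
      rw [mul_assoc]
      congr 1
      have h3 : Complex.normSq (1 + (l : ℂ) * F x) ≠ 0 := (Complex.normSq_pos.2 h2).ne'
      have h4 : Complex.normSq (1 + (l : ℂ) * F x) = Complex.normSq (F x) *
        ((l - -((F x).re / Complex.normSq (F x))) ^ 2
          + ((F x).im / Complex.normSq (F x)) ^ 2) := by
        have h5 : Complex.normSq (F x) = (F x).re ^ 2 + (F x).im ^ 2 := by
          rw [Complex.normSq_apply]; ring
        have h6 : Complex.normSq (1 + (l : ℂ) * F x)
            = (1 + l * (F x).re) ^ 2 + (l * (F x).im) ^ 2 := by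
          rw [Complex.normSq_apply]; simp; ring
        rw [h6]
        rw [h5] at hN ⊢
        field_simp
        ring
      rw [h4, mul_inv]
      field_simp
    · have h5 : (Alam l) (ψ x) - z x • ψ x = (1 + (l : ℂ) * F x) • φ := by
        rw [hAlam]
        have := hψe x
        simp only [add_apply, smul_apply,
          ContinuousLinearMap.smulRight_apply, innerSL_apply_apply]
        rw [add_sub_right_comm, this, add_smul, one_smul, mul_smul]
      rw [map_smul, smul_comm, ← smul_sub, h5, smul_smul, inv_mul_cancel₀ h2, one_smul]

end

section
variable {f : ℝ → ℝ}

lemma mul_pk_integrable (hf : Continuous f) (hfc : HasCompactSupport f) {y : ℝ} (hy : 0 < y)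
    (E : ℝ) : Integrable fun x => f x * pk y x E := by
  refine Continuous.integrable_of_hasCompactSupport ?_ hfc.mul_right
  exact hf.mul ((pk_cont hy).comp (by fun_prop : Continuous fun x : ℝ => (x, E)))

/-- Poisson smoothing of `f`. -/
noncomputable def psm (f : ℝ → ℝ) (y E : ℝ) : ℝ := ∫ t, f (E + y * t) * pk 1 0 t

lemma psm_cont (hf : Continuous f) (hfc : HasCompactSupport f) :
    Continuous (fun p : ℝ × ℝ => psm f p.1 p.2) := by
  obtain ⟨C, hC⟩ := hfc.exists_bound_of_continuous hf
  unfold psm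
  refine continuous_of_dominated (bound := fun t => C * pk 1 0 t) ?_ ?_ ?_ ?_
  · intro p
    have := pk_cont' one_pos 0
    exact (Continuous.mul (by fun_prop) this).aestronglyMeasurable
  · intro p
    refine Filter.Eventually.of_forall fun t => ?_
    rw [norm_mul, Real.norm_of_nonneg (pk_pos one_pos 0 t).le]
    exact mul_le_mul_of_nonneg_right (hC _) (pk_pos one_pos 0 t).le
  · exact (pk_integrable one_pos 0).const_mul C
  · refine Filter.Eventually.of_forall fun t => ?_
    fun_prop

lemma psm_zero : psm f 0 = f := by
  ext E
  simp [psm, integral_const_mul, pk_integral one_pos]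

lemma psm_eq {y : ℝ} (hy : 0 < y) (E : ℝ) : psm f y E = ∫ x, f x * pk y x E := by
  have h1 := Measure.integral_comp_mul_left (fun x => f (E + x) * pk 1 0 (x / y)) y
  have h2 := integral_add_left_eq_self (μ := volume) (fun x => f x * pk y x E) E
  rw [← h2]
  unfold psm
  simp only [mul_div_cancel_left₀ _ hy.ne'] at h1
  rw [h1, smul_eq_mul, ← integral_const_mul]
  refine integral_congr_ae (Filter.Eventually.of_forall fun x => ?_)
  simp only [pk, abs_of_pos (inv_pos.2 hy)]
  have : (x ^ 2 + y ^ 2) ≠ 0 := by positivity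
  have h3 : ((x / y - 0) ^ 2 + 1 ^ 2)⁻¹ = y ^ 2 * (x ^ 2 + y ^ 2)⁻¹ := by
    rw [show (x / y - 0) ^ 2 + 1 ^ 2 = (x ^ 2 + y ^ 2) * (y ^ 2)⁻¹ by field_simp; ring]
    rw [mul_inv, inv_inv, mul_comm]
  rw [h3, show (E - (E + x)) ^ 2 = x ^ 2 by ring]
  field_simp

lemma psm_bound (hf : Continuous f) (hfc : HasCompactSupport f) :
    ∃ C, ∀ y, 0 < y → y ≤ 1 → ∀ E, |psm f y E| ≤ C * pk 1 0 E := by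
  obtain ⟨M, hM⟩ := (hfc.mul_right (f' := fun x => 1 + 2 * x ^ 2)).exists_bound_of_continuous
    (by fun_prop)
  have hfi : Integrable f := hf.integrable_of_hasCompactSupport hfc
  refine ⟨Real.pi * (M + 2 * Real.pi⁻¹ * ∫ x, |f x|), fun y hy hy1 E => ?_⟩
  have h1 : |psm f y E| * (1 + E ^ 2) ≤ M + 2 * Real.pi⁻¹ * ∫ x, |f x| := by
    have hI : Integrable fun x => pk y x E := by
      simp_rw [pk_symm y _ E]
      exact pk_integrable hy E
    calc |psm f y E| * (1 + E ^ 2) ≤ (∫ x, |f x * pk y x E|) * (1 + E ^ 2) := by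
          rw [psm_eq hy]
          gcongr
          exact abs_integral_le_integral_abs
      _ = ∫ x, |f x * pk y x E| * (1 + E ^ 2) := by rw [integral_mul_const]
      _ ≤ ∫ x, (M * pk y x E + 2 * Real.pi⁻¹ * |f x|) := by
          refine integral_mono ((mul_pk_integrable hf hfc hy E).abs.mul_const _)
            ((hI.const_mul M).add (hfi.abs.const_mul _)) fun x => ?_
          have hp := pk_pos hy x E
          have hm := hM x
          rw [Real.norm_eq_abs, Pi.mul_apply, abs_mul,
            abs_of_pos (by positivity : 0 < 1 + 2 * x ^ 2)] at hm
          have hk : (E - x) ^ 2 * pk y x E ≤ Real.pi⁻¹ := by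
            have : 0 < (E - x) ^ 2 + y ^ 2 := by positivity
            have e : (E - x) ^ 2 * pk y x E
              = Real.pi⁻¹ * (y * ((E - x) ^ 2 / ((E - x) ^ 2 + y ^ 2))) := by
              unfold pk; field_simp
            rw [e]
            have h3 : (E - x) ^ 2 / ((E - x) ^ 2 + y ^ 2) ≤ 1 := by
              rw [div_le_one this]; nlinarith
            have h4 : y * ((E - x) ^ 2 / ((E - x) ^ 2 + y ^ 2)) ≤ 1 :=
              mul_le_one₀ hy1 (by positivity) h3
            exact mul_le_of_le_one_right (by positivity) h4
          have hE : 1 + E ^ 2 ≤ (1 + 2 * x ^ 2) + 2 * (E - x) ^ 2 := by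
            nlinarith [sq_nonneg (E - 2 * x)]
          simp only [abs_mul, abs_of_pos hp]
          calc |f x| * pk y x E * (1 + E ^ 2)
              ≤ |f x| * pk y x E * ((1 + 2 * x ^ 2) + 2 * (E - x) ^ 2) := by gcongr
            _ = (|f x| * (1 + 2 * x ^ 2)) * pk y x E
                + 2 * ((E - x) ^ 2 * pk y x E) * |f x| := by ring
            _ ≤ _ := by gcongr
      _ = _ := by
          rw [integral_add (hI.const_mul M) (hfi.abs.const_mul _), integral_const_mul,
            integral_const_mul]
          simp_rw [pk_symm y _ E]
          rw [pk_integral hy, mul_one]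
  rw [← le_div_iff₀ (by positivity)] at h1
  refine h1.trans (le_of_eq ?_)
  unfold pk
  rw [show (E - 0) ^ 2 + 1 ^ 2 = 1 + E ^ 2 by ring]
  field_simp

end

section
variable {H : Type*} [NormedAddCommGroup H] [InnerProductSpace ℂ H] [CompleteSpace H]

/-- the functional `T ↦ re ⟪φ, T φ⟫`. -/
noncomputable def qf (φ : H) : (H →L[ℂ] H) →L[ℝ] ℝ :=
  (Complex.reCLM.comp ((innerSL ℂ φ).restrictScalars ℝ)).comp
    ((ContinuousLinearMap.apply ℂ H φ).restrictScalars ℝ)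

lemma qf_apply (φ : H) (T : H →L[ℂ] H) : qf φ T = (inner (𝕜 := ℂ) φ (T φ)).re := rfl

lemma qf_mono (φ : H) {S T : H →L[ℂ] H} (h : S ≤ T) : qf φ S ≤ qf φ T := by
  have := ((ContinuousLinearMap.le_def S T).1 h).re_inner_nonneg_right φ
  rw [sub_apply, inner_sub_right] at this
  simpa [qf_apply] using this

lemma qf_abs_le (φ : H) (B : H →L[ℂ] H) (g : ℝ → ℝ) (hg : Continuous g) (C : ℝ)
    (h : ∀ E, |g E| ≤ C * pk 1 0 E) : |qf φ (cfc g B)| ≤ C * qf φ (cfc (pk 1 0) B) := by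
  have hc := pk_cont' one_pos 0
  have h0 : C * qf φ (cfc (pk 1 0) B) = qf φ (cfc (fun E => C * pk 1 0 E) B) := by
    rw [cfc_const_mul C (pk 1 0) B hc.continuousOn, map_smul, smul_eq_mul]
  rw [h0, abs_le]
  constructor
  · rw [← map_neg, ← cfc_neg]
    refine qf_mono φ (cfc_mono (fun E _ => ?_) (by fun_prop) (by fun_prop))
    exact (abs_le.1 (h E)).1
  · refine qf_mono φ (cfc_mono (fun E _ => ?_) (by fun_prop) (by fun_prop))
    exact (abs_le.1 (h E)).2

lemma qf_psm (φ : H) (B : H →L[ℂ] H) (hB : IsSelfAdjoint B) {f : ℝ → ℝ} (hf : Continuous f)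
    (hfc : HasCompactSupport f) {y : ℝ} (hy : 0 < y) :
    qf φ (cfc (psm f y) B) = ∫ x, f x * qf φ (cfc (pk y x) B) := by
  have hfi : Integrable f := hf.integrable_of_hasCompactSupport hfc
  have h1 : psm f y = fun E => ∫ x, f x * pk y x E := by ext E; exact psm_eq hy E
  have hcont : Continuous (Function.uncurry fun x E => f x * pk y x E) :=
    (hf.comp continuous_fst).mul (pk_cont hy)
  have hbd : ∀ᵐ x : ℝ, ∀ E ∈ spectrum ℝ B, ‖f x * pk y x E‖ ≤ |f x| * (Real.pi⁻¹ * y⁻¹) := by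
    refine Filter.Eventually.of_forall fun x E _ => ?_
    rw [norm_mul, Real.norm_of_nonneg (pk_pos hy x E).le, Real.norm_eq_abs]
    exact mul_le_mul_of_nonneg_left (pk_le hy x E) (abs_nonneg _)
  have hbi : HasFiniteIntegral (fun x => |f x| * (Real.pi⁻¹ * y⁻¹)) volume :=
    (hfi.abs.mul_const _).2
  rw [h1, cfc_integral (fun x E => f x * pk y x E) _ B hcont.continuousOn hbd hbi hB,
    ← ContinuousLinearMap.integral_comp_comm]
  · refine integral_congr_ae (Filter.Eventually.of_forall fun x => ?_)
    simp only
    rw [cfc_const_mul _ _ B (pk_cont' hy x).continuousOn, map_smul, smul_eq_mul]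
  · exact integrable_cfc (fun x E => f x * pk y x E) _ B hcont.continuousOn hbd hbi hB

end

open Filter Topology

/-- **Spectral averaging for rank-one perturbations.** Let `A` be a bounded self-adjoint
operator on a complex Hilbert space and `φ ≠ 0`. For `λ ∈ ℝ` let
`A_λ = A + λ ⟨φ, ·⟩ φ`. For every continuous compactly supported `f : ℝ → ℝ`, the function
`λ ↦ ⟨φ, f(A_λ) φ⟩` (defined via the continuous functional calculus, and real-valued) is
Lebesgue integrable, and `∫ ⟨φ, f(A_λ) φ⟩ dλ = ∫ f(E) dE`. -/
theorem spectral_averaging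
    {H : Type*} [NormedAddCommGroup H] [InnerProductSpace ℂ H] [CompleteSpace H]
    (A : H →L[ℂ] H) (hA : IsSelfAdjoint A) (φ : H) (hφ : φ ≠ 0)
    (Alam : ℝ → (H →L[ℂ] H))
    (hAlam : ∀ lam : ℝ, Alam lam = A + (lam : ℂ) • ((innerSL ℂ φ).smulRight φ))
    (f : ℝ → ℝ) (hf : Continuous f) (hfc : HasCompactSupport f) :
    Integrable (fun lam : ℝ => (inner (𝕜 := ℂ) φ ((cfc f (Alam lam)) φ)).re) volume ∧
    ∫ lam : ℝ, (inner (𝕜 := ℂ) φ ((cfc f (Alam lam)) φ)).re = ∫ E : ℝ, f E := by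
  have hfi : Integrable f := hf.integrable_of_hasCompactSupport hfc
  have hsa : ∀ l, IsSelfAdjoint (Alam l) := by
    intro l
    rw [hAlam, ContinuousLinearMap.isSelfAdjoint_iff_isSymmetric]
    have hs := ContinuousLinearMap.isSelfAdjoint_iff_isSymmetric.1 hA
    intro u v
    have h1 : inner ℂ (A u) v = inner ℂ u (A v) := hs u v
    change inner ℂ ((A + (l : ℂ) • ((innerSL ℂ φ).smulRight φ)) u) v
      = inner ℂ u ((A + (l : ℂ) • ((innerSL ℂ φ).smulRight φ)) v)
    simp only [add_apply, smul_apply, ContinuousLinearMap.smulRight_apply, innerSL_apply_apply,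
      inner_add_left, inner_add_right, inner_smul_left, inner_smul_right, h1,
      Complex.conj_ofReal, inner_conj_symm]
    ring
  have key := rank_one_pk A hA φ hφ Alam hsa hAlam
  simp only [← qf_apply] at key ⊢
  -- the smoothed statement
  have hsm : ∀ y : ℝ, 0 < y → Integrable (fun l => qf φ (cfc (psm f y) (Alam l))) ∧
      ∫ l, qf φ (cfc (psm f y) (Alam l)) = ∫ E, f E := by
    intro y hy
    obtain ⟨a, b, ha, hb, hb0, hab⟩ := key y hy
    simp_rw [qf_psm φ _ (hsa _) hf hfc hy, hab]
    have hm : AEStronglyMeasurable (fun p : ℝ × ℝ => f p.2 * pk (b p.2) (a p.2) p.1)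
        (volume.prod volume) := by
      have := hf.measurable
      unfold pk
      exact Measurable.aestronglyMeasurable (by fun_prop)
    have hI : Integrable (fun p : ℝ × ℝ => f p.2 * pk (b p.2) (a p.2) p.1)
        (volume.prod volume) := by
      rw [integrable_prod_iff' hm]
      refine ⟨Eventually.of_forall fun x => (pk_integrable (hb0 x) (a x)).const_mul (f x), ?_⟩
      refine hfi.norm.congr (Eventually.of_forall fun x => ?_)
      simp only [norm_mul, Real.norm_of_nonneg (pk_pos (hb0 x) _ _).le]
      rw [integral_const_mul, pk_integral (hb0 x), mul_one]
    refine ⟨hI.integral_prod_left, ?_⟩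
    rw [integral_integral_swap hI]
    refine integral_congr_ae (Eventually.of_forall fun x => ?_)
    simp only
    rw [integral_const_mul, pk_integral (hb0 x), mul_one]
  obtain ⟨C, hC⟩ := psm_bound hf hfc
  have hpc := psm_cont hf hfc
  have hpc' : ∀ y, Continuous (psm f y) := fun y =>
    hpc.comp (by fun_prop : Continuous fun E : ℝ => (y, E))
  set s : ℕ → ℝ := fun n => 1 / ((n : ℝ) + 1) with hs
  have hs0 : ∀ n, 0 < s n := fun n => by simp only [hs]; positivity
  have hs1 : ∀ n, s n ≤ 1 := fun n => by
    simp only [hs]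
    rw [div_le_one (by positivity)]
    linarith [(Nat.cast_nonneg n : (0 : ℝ) ≤ n)]
  have hst : Tendsto s atTop (𝓝 0) := tendsto_one_div_add_atTop_nhds_zero_nat
  have hlim : ∀ l, Tendsto (fun n => qf φ (cfc (psm f (s n)) (Alam l))) atTop
      (𝓝 (qf φ (cfc f (Alam l)))) := by
    intro l
    have hu : TendstoUniformlyOn (psm f) f (𝓝 0) (spectrum ℝ (Alam l)) := by
      rw [tendstoUniformlyOn_iff_tendstoUniformly_comp_coe]
      have hcs : CompactSpace (spectrum ℝ (Alam l)) :=
        isCompact_iff_compactSpace.1 (ContinuousFunctionalCalculus.isCompact_spectrum _)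
      have := Continuous.tendstoUniformly
        (fun (y : ℝ) (E : spectrum ℝ (Alam l)) => psm f y E)
        (hpc.comp (by fun_prop : Continuous fun p : ℝ × spectrum ℝ (Alam l) =>
          (p.1, (p.2 : ℝ)))) 0
      rw [psm_zero] at this
      exact this
    have h1 := tendsto_cfc_fun (a := Alam l) hu
      (Eventually.of_forall fun y => (hpc' y).continuousOn)
    exact ((qf φ).continuous.tendsto _).comp (h1.comp hst)
  obtain ⟨a, b, ha, hb, hb0, hab⟩ := key 1 one_pos
  have hbi : Integrable (fun l => C * qf φ (cfc (pk 1 0) (Alam l))) := by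
    simp_rw [hab]
    exact (pk_integrable (hb0 0) _).const_mul _
  have hbd : ∀ n l, |qf φ (cfc (psm f (s n)) (Alam l))| ≤ C * qf φ (cfc (pk 1 0) (Alam l)) :=
    fun n l => qf_abs_le φ _ _ (hpc' _) C (hC _ (hs0 n) (hs1 n))
  have hmeas : AEStronglyMeasurable (fun l => qf φ (cfc f (Alam l))) volume :=
    aestronglyMeasurable_of_tendsto_ae atTop (fun n => (hsm (s n) (hs0 n)).1.1)
      (Eventually.of_forall hlim)
  refine ⟨hbi.mono' hmeas (Eventually.of_forall fun l => ?_), ?_⟩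
  · exact le_of_tendsto (hlim l).norm (Eventually.of_forall fun n => hbd n l)
  · have h1 := tendsto_integral_of_dominated_convergence _
      (fun n => (hsm (s n) (hs0 n)).1.1) hbi
      (fun n => Eventually.of_forall (hbd n)) (Eventually.of_forall hlim)
    simp_rw [fun n => (hsm (s n) (hs0 n)).2] at h1
    exact tendsto_nhds_unique h1 tendsto_const_nhds
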